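/- The 4×4 matrix multiplication tensor over ℝ has border rank at most 46: the tensor M ∈ ℝ^{16} ⊗ ℝ^{16} ⊗ ℝ^{16}, defined componentwise (indexing each ℝ^{16} by pairs from {1,2,3,4}×{1,2,3,4}) by M_{(i₁,i₂),(j₁,j₂),(k₁,k₂)} = δ_{i₁j₁} δ_{j₂k₁} δ_{i₂k₂}, lies in the topological closure of the set of tensors expressible as a sum of at most 46 rank-one tensors, i.e., the closure of { T : ∃ vectors u_t, v_t, w_t ∈ ℝ^{16} (t = 1,…,46), T_{p,q,r} = ∑_{t=1}^{46} (u_t)_p (v_t)_q (w_t)_r for all p,q,r }. -/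

import Mathlib

open Filter Topology

namespace MatMulFour

section Identity

variable {R : Type*} [CommRing R]

/-- The linear forms whose cubes enter the degenerating algorithm. -/
def cubeForm (x : R) (A : Matrix (Fin 4) (Fin 4) R) : Fin 4 → R :=
  ![-A 1 0 - 2 * A 2 1 + x * A 0 0,
    2 * A 0 3 - A 3 2 + x * A 2 2,
    2 * A 0 3 - A 1 0 - x * A 1 1,
    2 * A 2 1 + A 3 2 + x * A 3 3]

/-- The coefficients of the cubes. -/
def cubeCoeff : Fin 4 → R := ![16, 16, -16, 16]

/-- The triples of linear forms that enter the degenerating algorithm together with their cyclic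
rotations. -/
def tripleForm (x : R) (A : Matrix (Fin 4) (Fin 4) R) : Fin 14 → Fin 3 → R :=
  ![![A 1 0 + x * A 1 1, -2 * A 0 3 + x * A 0 0,
      4 * A 0 3 - 2 * A 1 0 - 2 * x * A 1 1 - x ^ 3 * A 3 1],
    ![A 3 2 + x * A 3 3, 2 * A 2 1 + x * A 2 2,
      -4 * A 2 1 - 2 * A 3 2 - 2 * x * A 3 3 + x ^ 3 * A 1 3],
    ![-2 * A 2 1 + x * A 1 1, -A 1 0 + x * A 0 0,
      -2 * A 1 0 - 4 * A 2 1 + 2 * x * A 0 0 - x ^ 3 * A 0 2],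
    ![2 * A 0 3 + x * A 3 3, -A 3 2 + x * A 2 2,
      4 * A 0 3 - 2 * A 3 2 + 2 * x * A 2 2 + x ^ 3 * A 2 0],
    ![A 1 1, -2 * A 1 0 + 2 * x * A 0 0 - x ^ 2 * A 1 2, 2 * A 2 1 - x * A 1 1 + x ^ 2 * A 0 1],
    ![A 3 3, -2 * A 3 2 + 2 * x * A 2 2 + x ^ 2 * A 3 0, 2 * A 0 3 + x * A 3 3 - x ^ 2 * A 2 3],
    ![2 * A 1 0 + 2 * x * A 1 1 - x ^ 2 * A 3 0, A 0 0, -2 * A 0 3 + x * A 0 0 + x ^ 2 * A 0 1],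
    ![2 * A 3 2 + 2 * x * A 3 3 + x ^ 2 * A 1 2, A 2 2, 2 * A 2 1 + x * A 2 2 + x ^ 2 * A 2 3],
    ![-16 * A 0 1 - A 0 2 + 16 * x * A 0 0, A 1 3, A 2 0 + x * A 3 0],
    ![A 2 0 - 16 * A 2 3 + 16 * x * A 2 2, A 3 1, A 0 2 + x * A 1 2],
    ![A 2 0, 16 * A 0 1 + A 3 1 + 16 * x * A 1 1, -A 1 3 + x * A 1 2],
    ![A 0 2, A 1 3 - 16 * A 2 3 - 16 * x * A 3 3, -A 3 1 + x * A 3 0],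
    ![A 2 0 + 16 * x * A 3 3, A 3 1 + 16 * x * A 0 0, A 0 2 + A 1 3],
    ![A 0 2 - 16 * x * A 1 1, A 1 3 - 16 * x * A 2 2, A 2 0 + A 3 1]]

/-- The coefficients of the triples. -/
def tripleCoeff (x : R) : Fin 14 → R :=
  ![8, 8, -8, -8, -8 * x, 8 * x, 8 * x, 8 * x, -x ^ 2, -x ^ 2, x ^ 2, -x ^ 2, x ^ 2, -x ^ 2]

/-- The cubic form whose cyclic symmetrization is the error term of the algorithm. -/
def errorForm (x : R) (A B C : Matrix (Fin 4) (Fin 4) R) : R :=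
  -8 * A 0 0 * B 0 0 * C 3 0 - 16 * A 0 0 * B 0 2 * C 2 1
    + 256 * A 0 0 * B 0 2 * C 3 3 - 16 * A 0 0 * B 1 3 * C 3 0
    + 256 * A 0 0 * B 1 3 * C 3 3 - 8 * A 0 0 * B 3 1 * C 1 0
    - 8 * A 0 2 * B 1 1 * C 1 0 + 16 * A 0 2 * B 3 3 * C 3 0
    - 16 * A 0 3 * B 2 2 * C 2 0 + 16 * A 0 3 * B 3 1 * C 1 1
    - 8 * A 1 1 * B 1 1 * C 1 2 + 16 * A 1 1 * B 1 2 * C 2 0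
    - 256 * A 1 1 * B 2 2 * C 2 0 - 256 * A 1 1 * B 2 2 * C 3 1
    + 8 * A 1 2 * B 2 2 * C 2 2 - 16 * A 1 2 * B 2 2 * C 3 1
    + 8 * A 1 3 * B 3 2 * C 2 2 + 16 * A 1 3 * B 3 3 * C 2 1
    + 8 * A 2 0 * B 3 3 * C 3 2 + 8 * A 3 0 * B 3 3 * C 3 3
    - 8 * x * A 0 0 * B 0 1 * C 3 0 + 8 * x * A 0 0 * B 0 2 * C 1 1
    - 8 * x * A 0 0 * B 3 1 * C 1 1 + 8 * x * A 0 1 * B 1 1 * C 1 2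
    + 8 * x * A 1 2 * B 2 2 * C 2 3 + 8 * x * A 1 3 * B 3 3 * C 2 2
    - 8 * x * A 2 0 * B 3 3 * C 2 2 - 8 * x * A 2 3 * B 3 3 * C 3 0

/-- A cyclically symmetric algorithm with `4 + 14 * 3` products which computes `tr (ABC)` up to
an error of higher order in `x`. -/
theorem sum_forms_eq (x : R) (A B C : Matrix (Fin 4) (Fin 4) R) :
    ∑ s, cubeCoeff s * (cubeForm x C s * cubeForm x A s * cubeForm x B s) +
      ∑ t, ∑ c, tripleCoeff x t *
        (tripleForm x C t c * tripleForm x A t (c + 1) * tripleForm x B t (c + 2)) =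
    16 * x ^ 3 * (A * B * C).trace +
      x ^ 4 * (errorForm x A B C + errorForm x B C A + errorForm x C A B) := by
  simp [Fin.sum_univ_succ, cubeCoeff, cubeForm, tripleCoeff, tripleForm, errorForm,
    Matrix.trace, Matrix.mul_apply]
  ring

/-- The symmetrized error term of the algorithm, as an array of its coefficients. -/
def errorTensor (x : R) (p q r : Fin 4 × Fin 4) : R :=
  errorForm x (.single q.1 q.2 1) (.single r.1 r.2 1) (.single p.2 p.1 1) +
    errorForm x (.single r.1 r.2 1) (.single p.2 p.1 1) (.single q.1 q.2 1) +
    errorForm x (.single p.2 p.1 1) (.single q.1 q.2 1) (.single r.1 r.2 1)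

/-- The matrix multiplication tensor consists of the traces of products of matrix units. -/
theorem trace_single_mul_single_mul_single (p q r : Fin 4 × Fin 4) :
    (Matrix.single q.1 q.2 (1 : R) * Matrix.single r.1 r.2 1 * Matrix.single p.2 p.1 1).trace =
      (if p.1 = q.1 then 1 else 0) * (if q.2 = r.1 then 1 else 0) *
        (if p.2 = r.2 then 1 else 0) := by
  obtain ⟨p₁, p₂⟩ := p
  obtain ⟨q₁, q₂⟩ := q
  obtain ⟨r₁, r₂⟩ := r
  by_cases h₁ : q₂ = r₁ <;> by_cases h₂ : p₂ = r₂ <;> by_cases h₃ : p₁ = q₁ <;>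
    simp_all [Matrix.trace_single_eq_of_ne, eq_comm, Matrix.single_mul_single_of_ne]

end Identity

/-- For `x ≠ 0` the matrix multiplication tensor is, up to an error of order `x`, a sum of
`4 + 14 * 3` rank-one tensors. -/
theorem exists_rank_decomposition {x : ℝ} (hx : x ≠ 0) :
    ∃ u v w : Fin 46 → (Fin 4 × Fin 4) → ℝ, ∀ p q r : Fin 4 × Fin 4,
      ((if p.1 = q.1 then 1 else 0) * (if q.2 = r.1 then 1 else 0) *
        (if p.2 = r.2 then 1 else 0) : ℝ) + x / 16 * errorTensor x p q r =
      ∑ t, u t p * v t q * w t r := by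
  let e : Fin 4 ⊕ (Fin 14 × Fin 3) ≃ Fin 46 :=
    (Equiv.sumCongr (Equiv.refl _) finProdFinEquiv).trans finSumFinEquiv
  let u : Fin 4 ⊕ (Fin 14 × Fin 3) → (Fin 4 × Fin 4) → ℝ := fun t p =>
    (16 * x ^ 3)⁻¹ * t.elim (fun s => cubeCoeff s * cubeForm x (.single p.2 p.1 1) s)
      fun tc => tripleCoeff x tc.1 * tripleForm x (.single p.2 p.1 1) tc.1 tc.2
  let v : Fin 4 ⊕ (Fin 14 × Fin 3) → (Fin 4 × Fin 4) → ℝ := fun t q =>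
    t.elim (cubeForm x (.single q.1 q.2 1))
      fun tc => tripleForm x (.single q.1 q.2 1) tc.1 (tc.2 + 1)
  let w : Fin 4 ⊕ (Fin 14 × Fin 3) → (Fin 4 × Fin 4) → ℝ := fun t r =>
    t.elim (cubeForm x (.single r.1 r.2 1))
      fun tc => tripleForm x (.single r.1 r.2 1) tc.1 (tc.2 + 2)
  refine ⟨fun t => u (e.symm t), fun t => v (e.symm t), fun t => w (e.symm t), fun p q r => ?_⟩
  have key := sum_forms_eq x (.single q.1 q.2 1) (.single r.1 r.2 1) (.single p.2 p.1 1)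
  rw [trace_single_mul_single_mul_single] at key
  rw [e.symm.sum_comp fun t => u t p * v t q * w t r]
  simp only [mul_assoc, ← Finset.mul_sum] at key
  simp only [Fintype.sum_sum_type, Fintype.sum_prod_type, u, v, w, Sum.elim_inl, Sum.elim_inr,
    mul_assoc, ← Finset.mul_sum]
  rw [eq_inv_mul_iff_mul_eq₀ (by positivity), key, errorTensor]
  ring

theorem continuous_errorTensor (p q r : Fin 4 × Fin 4) :
    Continuous fun x : ℝ => errorTensor x p q r := by
  unfold errorTensor errorForm
  fun_prop

end MatMulFour

/-- The 4×4 matrix multiplication tensor over ℝ has border rank at most 46: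
it lies in the topological closure of the set of tensors (arrays indexed by three pairs from
`Fin 4 × Fin 4`) expressible as a sum of at most 46 rank-one tensors. -/
theorem matmul_tensor_4x4_border_rank_le_46 :
    (fun (p q r : Fin 4 × Fin 4) =>
        ((if p.1 = q.1 then 1 else 0) * (if q.2 = r.1 then 1 else 0) *
          (if p.2 = r.2 then 1 else 0) : ℝ))
      ∈ closure {A : (Fin 4 × Fin 4) → (Fin 4 × Fin 4) → (Fin 4 × Fin 4) → ℝ |
          ∃ u v w : Fin 46 → (Fin 4 × Fin 4) → ℝ,
            ∀ p q r, A p q r = ∑ t : Fin 46, u t p * v t q * w t r} := by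
  have hlim : Tendsto (fun (x : ℝ) (p q r : Fin 4 × Fin 4) =>
      ((if p.1 = q.1 then 1 else 0) * (if q.2 = r.1 then 1 else 0) *
        (if p.2 = r.2 then 1 else 0) : ℝ) + x / 16 * MatMulFour.errorTensor x p q r) (𝓝[≠] 0)
      (𝓝 fun p q r => (if p.1 = q.1 then 1 else 0) * (if q.2 = r.1 then 1 else 0) *
        (if p.2 = r.2 then 1 else 0)) := by
    refine tendsto_nhdsWithin_of_tendsto_nhds ?_
    simp only [tendsto_pi_nhds]
    intro p q r
    have hcont := (continuous_id.div_const (16 : ℝ)).mul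
      (MatMulFour.continuous_errorTensor p q r)
    simpa using (hcont.tendsto 0).const_add _
  refine mem_closure_of_tendsto hlim ?_
  filter_upwards [self_mem_nhdsWithin] with x hx
  exact MatMulFour.exists_rank_decomposition hx
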